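/- arXiv:2102.07290 — 2 statements merged into one kernel-verified Lean document; each statement's English description precedes it below -/
import Mathlib

section
/- For any positive integer n and prime power q, the number of nilpotent n×n matrices over the finite field F_q is exactly q^(n^2 - n). -/
open Module
open scoped Matrix

namespace Matrix

variable {l m R : Type*} [Fintype l] [Fintype m] [DecidableEq l] [DecidableEq m] [CommRing R]

/-- Powers of a block upper triangular matrix are block upper triangular. -/
lemma exists_fromBlocks_zero₂₁_pow (A : Matrix l l R) (B : Matrix l m R) (D : Matrix m m R)
    (n : ℕ) : ∃ B', fromBlocks A B 0 D ^ n = fromBlocks (A ^ n) B' 0 (D ^ n) := by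
  induction n with
  | zero => exact ⟨0, by simp⟩
  | succ n ih =>
    obtain ⟨B', hB'⟩ := ih
    exact ⟨A ^ n * B + B' * D, by simp [pow_succ, hB', fromBlocks_multiply]⟩

/-- A block upper triangular matrix is nilpotent iff its diagonal blocks are. -/
lemma isNilpotent_fromBlocks_zero₂₁_iff {A : Matrix l l R} {B : Matrix l m R}
    {D : Matrix m m R} :
    IsNilpotent (fromBlocks A B 0 D) ↔ IsNilpotent A ∧ IsNilpotent D := by
  constructor
  · rintro ⟨n, hn⟩
    obtain ⟨B', hB'⟩ := exists_fromBlocks_zero₂₁_pow A B D n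
    rw [hB', ← fromBlocks_zero, fromBlocks_inj] at hn
    exact ⟨⟨n, hn.1⟩, ⟨n, hn.2.2.2⟩⟩
  · rintro ⟨⟨a, ha⟩, ⟨d, hd⟩⟩
    obtain ⟨B', hB'⟩ := exists_fromBlocks_zero₂₁_pow A B D (a + d)
    refine ⟨(a + d) * 2, ?_⟩
    rw [pow_mul, hB', pow_add, pow_add, ha, hd]
    simp [pow_two, fromBlocks_multiply]

end Matrix

section Shift

variable {K V : Type*} [Field K] [AddCommGroup V] [Module K V] {k : ℕ}

/-- If `T` shifts the family `w`, then `w` is the start of the orbit of `w 0` under `T`. -/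
lemma pow_apply_zero_of_shift {T : End K V} {w : Fin (k + 1) → V}
    (hT : ∀ i : Fin k, T (w i.castSucc) = w i.succ) (i : Fin (k + 1)) :
    (T ^ (i : ℕ)) (w 0) = w i := by
  induction i using Fin.induction with
  | zero => simp
  | succ i ih =>
    rw [Fin.val_succ, pow_succ', Module.End.mul_apply, ← hT, ← ih, Fin.val_castSucc]

/-- An endomorphism shifting a basis is nilpotent iff it kills the last basis vector. -/
lemma isNilpotent_iff_of_shift_basis {T : End K V} (b : Basis (Fin (k + 1)) K V)
    (hT : ∀ i : Fin k, T (b i.castSucc) = b i.succ) :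
    IsNilpotent T ↔ T (b (Fin.last k)) = 0 := by
  have := b.finiteDimensional_of_finite
  have hpow := pow_apply_zero_of_shift hT
  have hlast : (T ^ (k + 1)) (b 0) = T (b (Fin.last k)) := by
    rw [pow_succ', Module.End.mul_apply, ← hpow (Fin.last k), Fin.val_last]
  constructor
  · intro h
    have hz : T ^ (k + 1) = 0 := by
      have := LinearMap.aeval_self_charpoly T
      rwa [h.charpoly_eq_X_pow_finrank, map_pow, Polynomial.aeval_X,
        finrank_eq_card_basis b, Fintype.card_fin] at this
    rw [← hlast, hz, LinearMap.zero_apply]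
  · intro h
    refine ⟨k + 1, b.ext fun i => ?_⟩
    rw [← hpow i, ← Module.End.mul_apply, ← pow_add, add_comm, pow_add, Module.End.mul_apply,
      hlast, h, map_zero, LinearMap.zero_apply]

/-- The square matrix whose last column is `c` and whose other columns are those of the
lower shift matrix. -/
def shiftMatrix (c : Fin (k + 1) → K) : Matrix (Fin (k + 1)) (Fin (k + 1)) K :=
  (Matrix.of (Fin.snoc (fun j : Fin k => Pi.single j.succ 1) c))ᵀ

lemma shiftMatrix_apply_castSucc (c : Fin (k + 1) → K) (i : Fin (k + 1)) (j : Fin k) :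
    shiftMatrix c i j.castSucc = (Pi.single j.succ 1 : Fin (k + 1) → K) i := by
  simp [shiftMatrix]

lemma shiftMatrix_apply_last (c : Fin (k + 1) → K) (i : Fin (k + 1)) :
    shiftMatrix c i (Fin.last k) = c i := by
  simp [shiftMatrix]

lemma isNilpotent_shiftMatrix_iff {c : Fin (k + 1) → K} :
    IsNilpotent (shiftMatrix c) ↔ c = 0 := by
  rw [← Matrix.isNilpotent_toLin'_iff, isNilpotent_iff_of_shift_basis (Pi.basisFun K _)]
  · simp only [Pi.basisFun_apply, Matrix.toLin'_apply, Matrix.mulVec_single_one]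
    simp [shiftMatrix, funext_iff]
  · intro i
    ext j
    simp [shiftMatrix_apply_castSucc]

end Shift

section Blocks

variable {K V κ : Type*} [Field K] [AddCommGroup V] [Module K V] {k : ℕ}
  [Fintype κ] [DecidableEq κ]

/-- The endomorphisms that shift `b ∘ inl` and preserve its span are those whose matrix is block
upper triangular with a `shiftMatrix` as first block. -/
lemma shift_iff_exists_toLin (b : Basis (Fin (k + 1) ⊕ κ) K V) (T : End K V) :
    ((∀ i : Fin k, T (b (.inl i.castSucc)) = b (.inl i.succ)) ∧
      T (b (.inl (Fin.last k))) ∈ Submodule.span K (Set.range fun i => b (.inl i))) ↔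
    ∃ p : (Fin (k + 1) → K) × Matrix (Fin (k + 1)) κ K × Matrix κ κ K,
      Matrix.toLin b b (.fromBlocks (shiftMatrix p.1) p.2.1 0 p.2.2) = T := by
  constructor
  · rintro ⟨hT, hlast⟩
    obtain ⟨c, hc⟩ := (Submodule.mem_span_range_iff_exists_fun K).1 hlast
    refine ⟨(c, (LinearMap.toMatrix b b T).toBlocks₁₂, (LinearMap.toMatrix b b T).toBlocks₂₂),
      ?_⟩
    refine b.ext fun j => ?_
    rw [Matrix.toLin_self, Fintype.sum_sum_type]
    rcases j with j | j
    · induction j using Fin.lastCases with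
      | last => simp [shiftMatrix_apply_last, hc]
      | cast j => simp [shiftMatrix_apply_castSucc, hT, Pi.single_apply]
    · conv_rhs => rw [← Matrix.toLin_toMatrix b b T]
      rw [Matrix.toLin_self, Fintype.sum_sum_type]
      rfl
  · rintro ⟨p, rfl⟩
    simp only [Matrix.toLin_self, Fintype.sum_sum_type]
    refine ⟨fun i => ?_, ?_⟩
    · simp [shiftMatrix_apply_castSucc, Pi.single_apply]
    · simp only [Matrix.fromBlocks_apply₁₁, Matrix.fromBlocks_apply₂₁, Matrix.zero_apply,
        zero_smul, Finset.sum_const_zero, add_zero]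
      exact Submodule.sum_mem _ fun i _ => Submodule.smul_mem _ _ (Submodule.subset_span ⟨i, rfl⟩)

lemma toLin_fromBlocks_shiftMatrix_injective (b : Basis (Fin (k + 1) ⊕ κ) K V) :
    Function.Injective fun p : (Fin (k + 1) → K) × Matrix (Fin (k + 1)) κ K × Matrix κ κ K =>
      Matrix.toLin b b (.fromBlocks (shiftMatrix p.1) p.2.1 0 p.2.2) := by
  rintro ⟨c, B, D⟩ ⟨c', B', D'⟩ h
  obtain ⟨hc, hB, -, hD⟩ := Matrix.fromBlocks_inj.1 ((Matrix.toLin b b).injective h)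
  have : c = c' := funext fun i => by
    rw [← shiftMatrix_apply_last c i, hc, shiftMatrix_apply_last]
  simp_all

lemma isNilpotent_toLin_fromBlocks_shiftMatrix_iff (b : Basis (Fin (k + 1) ⊕ κ) K V)
    (c : Fin (k + 1) → K) (B : Matrix (Fin (k + 1)) κ K) (D : Matrix κ κ K) :
    IsNilpotent (Matrix.toLin b b (.fromBlocks (shiftMatrix c) B 0 D)) ↔
      c = 0 ∧ IsNilpotent D := by
  rw [← LinearMap.isNilpotent_toMatrix_iff b, LinearMap.toMatrix_toLin,
    Matrix.isNilpotent_fromBlocks_zero₂₁_iff, isNilpotent_shiftMatrix_iff]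

end Blocks

section Count

universe v

variable {K : Type*} {V : Type v} [Field K] [AddCommGroup V] [Module K V] {k : ℕ}

/-- Among the endomorphisms shifting `b ∘ inl` and preserving its span, the proportion of nilpotent
ones is `q ^ (-dim V)`, provided that this holds for `κ × κ` matrices. -/
lemma card_shift_mem_span {κ : Type*} [Fintype κ] [DecidableEq κ]
    (b : Basis (Fin (k + 1) ⊕ κ) K V)
    (hκ : Nat.card (Matrix κ κ K) =
      Nat.card K ^ Fintype.card κ * Nat.card {D : Matrix κ κ K // IsNilpotent D}) :
    Nat.card {T : End K V // (∀ i : Fin k, T (b (.inl i.castSucc)) = b (.inl i.succ)) ∧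
      T (b (.inl (Fin.last k))) ∈ Submodule.span K (Set.range fun i => b (.inl i))} =
    Nat.card K ^ finrank K V *
      Nat.card {T : End K V // ((∀ i : Fin k, T (b (.inl i.castSucc)) = b (.inl i.succ)) ∧
        T (b (.inl (Fin.last k))) ∈ Submodule.span K (Set.range fun i => b (.inl i))) ∧
        IsNilpotent T} := by
  let f : (Fin (k + 1) → K) × Matrix (Fin (k + 1)) κ K × Matrix κ κ K → End K V :=
    fun p => Matrix.toLin b b (.fromBlocks (shiftMatrix p.1) p.2.1 0 p.2.2)
  have hf : Function.Injective f := toLin_fromBlocks_shiftMatrix_injective b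
  have hall : Nat.card {T : End K V //
      (∀ i : Fin k, T (b (.inl i.castSucc)) = b (.inl i.succ)) ∧
        T (b (.inl (Fin.last k))) ∈ Submodule.span K (Set.range fun i => b (.inl i))} =
      Nat.card ((Fin (k + 1) → K) × Matrix (Fin (k + 1)) κ K × Matrix κ κ K) :=
    Nat.card_congr <| (Equiv.subtypeEquivRight (shift_iff_exists_toLin b)).trans
      (Equiv.ofInjective f hf).symm
  have hnil : Nat.card {T : End K V //
      ((∀ i : Fin k, T (b (.inl i.castSucc)) = b (.inl i.succ)) ∧
        T (b (.inl (Fin.last k))) ∈ Submodule.span K (Set.range fun i => b (.inl i))) ∧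
        IsNilpotent T} =
      Nat.card (Matrix (Fin (k + 1)) κ K × {D : Matrix κ κ K // IsNilpotent D}) := by
    let g : Matrix (Fin (k + 1)) κ K × {D : Matrix κ κ K // IsNilpotent D} → End K V :=
      fun p => f (0, p.1, p.2)
    have hg : Function.Injective g := by
      rintro ⟨B, D⟩ ⟨B', D'⟩ h
      have := hf h
      simp_all [Subtype.ext_iff]
    refine Nat.card_congr <| (Equiv.subtypeEquivRight fun T => ?_).trans
      (Equiv.ofInjective g hg).symm
    rw [shift_iff_exists_toLin]
    constructor
    · rintro ⟨⟨⟨c, B, D⟩, rfl⟩, hN⟩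
      obtain ⟨rfl, hD⟩ := (isNilpotent_toLin_fromBlocks_shiftMatrix_iff b c B D).1 hN
      exact ⟨(B, ⟨D, hD⟩), rfl⟩
    · rintro ⟨⟨B, D, hD⟩, rfl⟩
      exact ⟨⟨(0, B, D), rfl⟩,
        (isNilpotent_toLin_fromBlocks_shiftMatrix_iff b 0 B D).2 ⟨rfl, hD⟩⟩
  rw [hall, hnil, finrank_eq_card_basis b, Nat.card_prod, Nat.card_prod,
    Nat.card_prod, hκ, Fintype.card_sum, Nat.card_fun, Nat.card_fin,
    Fintype.card_fin, pow_add]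
  ring

open Classical in
/-- Split a finite set according to whether a map takes values in `W`, and by value otherwise. -/
lemma Nat.card_subtype_eq_add_sum_fiber {α β : Type*} [Finite α] [Fintype β]
    (p : α → Prop) (g : α → β) (W : Set β) :
    Nat.card {a // p a} = Nat.card {a // p a ∧ g a ∈ W} +
      ∑ v ∈ Finset.univ.filter (· ∉ W), Nat.card {a // p a ∧ g a = v} := by
  have := Fintype.ofFinite α
  simp only [Nat.card_eq_fintype_card, Fintype.card_subtype]
  rw [← Finset.card_filter_add_card_filter_not (s := Finset.univ.filter p) (g · ∈ W),
    Finset.filter_filter, Finset.card_eq_sum_card_fiberwise (f := g)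
      (s := (Finset.univ.filter p).filter (g · ∉ W)) (t := Finset.univ.filter (· ∉ W))
      (by intro a; simp +contextual)]
  refine congrArg₂ _ rfl (Finset.sum_congr rfl fun v hv => congrArg _ ?_)
  ext a
  simp only [Finset.mem_filter, Finset.mem_univ, true_and] at hv ⊢
  constructor
  · rintro ⟨⟨h, -⟩, h'⟩
    exact ⟨h, h'⟩
  · rintro ⟨h, rfl⟩
    exact ⟨⟨h, hv⟩, rfl⟩

lemma Module.Basis.sumExtend_inl {ι : Type*} {w : ι → V} (hw : LinearIndependent K w) (i : ι) :
    Basis.sumExtend hw (.inl i) = w i := by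
  rw [Basis.sumExtend, Basis.reindex_apply, Basis.extend_apply_self]
  rfl

lemma shift_snoc_iff (T : End K V) (w : Fin (k + 1) → V) (v : V) :
    (∀ i : Fin (k + 1), T (Fin.snoc (α := fun _ => V) w v i.castSucc) =
        Fin.snoc (α := fun _ => V) w v i.succ) ↔
      (∀ i : Fin k, T (w i.castSucc) = w i.succ) ∧ T (w (Fin.last k)) = v := by
  rw [Fin.forall_fin_succ']
  simp only [Fin.snoc_castSucc, Fin.succ_last, Fin.snoc_last, Fin.succ_castSucc]

/-- Among the endomorphisms shifting a linearly independent family, the proportion of nilpotent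
ones is `q ^ (-dim V)`, provided that this holds for all matrices of smaller size. -/
lemma card_shift [Finite V]
    (ih : ∀ (κ : Type v) [Fintype κ] [DecidableEq κ], Fintype.card κ < finrank K V →
      Nat.card (Matrix κ κ K) =
        Nat.card K ^ Fintype.card κ * Nat.card {D : Matrix κ κ K // IsNilpotent D})
    (d : ℕ) (w : Fin (k + 1) → V) (hw : LinearIndependent K w) (hd : k + 1 + d = finrank K V) :
    Nat.card {T : End K V // ∀ i : Fin k, T (w i.castSucc) = w i.succ} =
    Nat.card K ^ finrank K V *
      Nat.card {T : End K V // (∀ i : Fin k, T (w i.castSucc) = w i.succ) ∧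
        IsNilpotent T} := by
  classical
  have := Fintype.ofFinite V
  have : Finite (End K V) := DFunLike.finite _
  have : FiniteDimensional K V := .of_finite
  induction d generalizing k with
  | zero | succ d ihd =>
    have hcard : Fintype.card (Basis.sumExtendIndex hw) < finrank K V := by
      rw [finrank_eq_card_basis (Basis.sumExtend hw), Fintype.card_sum, Fintype.card_fin]
      omega
    have hspan := card_shift_mem_span (Basis.sumExtend hw) (ih _ hcard)
    simp only [Basis.sumExtend_inl] at hspan
    have hfib : ∀ v : V, v ∉ Submodule.span K (Set.range w) →
        Nat.card {T : End K V // (∀ i : Fin k, T (w i.castSucc) = w i.succ) ∧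
          T (w (Fin.last k)) = v} =
        Nat.card K ^ finrank K V *
          Nat.card {T : End K V // ((∀ i : Fin k, T (w i.castSucc) = w i.succ) ∧
            T (w (Fin.last k)) = v) ∧ IsNilpotent T} := by
      intro v hv
      have hwv : LinearIndependent K (Fin.snoc w v : Fin (k + 2) → V) :=
        linearIndependent_finSnoc.2 ⟨hw, hv⟩
      first
      | simpa only [shift_snoc_iff] using ihd _ hwv (by omega)
      | have := hwv.fintype_card_le_finrank
        rw [Fintype.card_fin] at this
        omega
    rw [Nat.card_subtype_eq_add_sum_fiber _ (fun T : End K V => T (w (Fin.last k)))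
        (Submodule.span K (Set.range w)),
      Nat.card_subtype_eq_add_sum_fiber (fun T : End K V => _ ∧ IsNilpotent T)
        (fun T : End K V => T (w (Fin.last k))) (Submodule.span K (Set.range w)),
      mul_add, Finset.mul_sum]
    simp only [and_right_comm (c := _ ∈ _), and_right_comm (c := _ = _), SetLike.mem_coe]
    rw [hspan]
    congr 1
    refine Finset.sum_congr rfl fun v hv => hfib v ?_
    simpa using hv

end Count

/-- A matrix over a finite field with `q` elements is nilpotent with probability `q ^ (-n)`. -/
lemma card_matrix_eq_mul_card_isNilpotent {K : Type} [Field K] [Finite K]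
    (κ : Type) [Fintype κ] [DecidableEq κ] :
    Nat.card (Matrix κ κ K) =
      Nat.card K ^ Fintype.card κ * Nat.card {D : Matrix κ κ K // IsNilpotent D} := by
  induction h : Fintype.card κ using Nat.strong_induction_on generalizing κ with
  | _ n ih =>
    subst h
    rcases isEmpty_or_nonempty κ with hκ | ⟨⟨j⟩⟩
    · have : Unique {D : Matrix κ κ K // IsNilpotent D} :=
        ⟨⟨0, .zero⟩, fun _ => Subsingleton.elim _ _⟩
      simp
    · let e : Matrix κ κ K ≃ End K (κ → K) := Matrix.toLin'.toEquiv
      have hcard : finrank K (κ → K) = Fintype.card κ := finrank_fintype_fun_eq_card K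
      have hj : (Pi.single j 1 : κ → K) ≠ 0 := by simp
      have key := card_shift (K := K) (V := κ → K) (k := 0)
        (fun κ' _ _ hκ' => ih _ (hcard ▸ hκ') κ' rfl) (Fintype.card κ - 1)
        (fun _ => Pi.single j 1) (LinearIndependent.of_subsingleton (ι := Fin 1) 0 hj)
        (by have := Fintype.card_pos_iff.2 ⟨j⟩; omega)
      simp only [IsEmpty.forall_iff, true_and, hcard] at key
      rw [Nat.card_congr e,
        Nat.card_congr (e.subtypeEquiv (q := fun T => IsNilpotent T) fun D =>
          (Matrix.isNilpotent_toLin'_iff D).symm), ← key]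
      exact (Nat.card_congr (Equiv.subtypeUnivEquiv fun _ => trivial)).symm

/-- **Fine–Herstein.** For any positive integer `n` and any finite field `F` with `q`
elements, the number of nilpotent `n × n` matrices over `F` is `q ^ (n^2 - n)`. -/
theorem fine_herstein_nilpotent_count (F : Type) [Field F] [Fintype F] (n : ℕ) (hn : 0 < n) :
    Nat.card {M : Matrix (Fin n) (Fin n) F // IsNilpotent M} =
      Fintype.card F ^ (n ^ 2 - n) := by
  have h := card_matrix_eq_mul_card_isNilpotent (K := F) (Fin n)
  rw [Fintype.card_fin, Nat.card_eq_fintype_card (α := F)] at h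
  refine Nat.eq_of_mul_eq_mul_left (pow_pos (Fintype.card_pos (α := F)) n) ?_
  rw [← pow_add, Nat.add_sub_cancel' (Nat.le_self_pow two_ne_zero n), ← h, Matrix]
  simp [← pow_mul, pow_two]
end

section
/- Let A_2(n,q) denote the number of absolutely indecomposable orbits of pairs of nilpotent n×n matrices over F_q under simultaneous conjugation. Then A_2(1,q) = 1, A_2(2,q) = 2q, and A_2(3,q) = q^4 + 3q^2 + 2q, as polynomial identities valid for all prime powers q. -/
/-- The space of `g`-tuples of `n × n` matrices over `F`. -/
abbrev MatTuple (F : Type) [Field F] (n g : ℕ) := Fin g → Matrix (Fin n) (Fin n) F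

/-- The set of orbits of `g`-tuples of `n × n` matrices over `F` under simultaneous
conjugation by invertible matrices. -/
abbrev TupleOrbits (F : Type) [Field F] (n g : ℕ) :=
  Quotient (MulAction.orbitRel (ConjAct (Matrix (Fin n) (Fin n) F)ˣ) (MatTuple F n g))

/-- A tuple `(M_1, …, M_g)` is decomposable if it is simultaneously conjugate to a tuple
of matrices in common block-diagonal form with two nontrivial diagonal blocks. -/
def IsDecomposableTuple {K : Type} [Field K] {n g : ℕ} (v : MatTuple K n g) : Prop :=
  ∃ d₁ d₂ : ℕ, 0 < d₁ ∧ 0 < d₂ ∧ ∃ (h : d₁ + d₂ = n)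
    (T : (Matrix (Fin n) (Fin n) K)ˣ) (A : MatTuple K d₁ g) (B : MatTuple K d₂ g),
    ∀ i, (↑T⁻¹ : Matrix (Fin n) (Fin n) K) * v i * (↑T : Matrix (Fin n) (Fin n) K) =
      Matrix.reindex (finSumFinEquiv.trans (finCongr h)) (finSumFinEquiv.trans (finCongr h))
        (Matrix.fromBlocks (A i) 0 0 (B i))

/-- A tuple is absolutely indecomposable if it remains indecomposable over the algebraic
closure of the base field. -/
def IsAbsIndecTuple {K : Type} [Field K] {n g : ℕ} (v : MatTuple K n g) : Prop :=
  ¬ IsDecomposableTuple (fun i => (v i).map (algebraMap K (AlgebraicClosure K)))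

/-- `M_g(n,q)`: the number of orbits of `g`-tuples of nilpotent `n × n` matrices over a
finite field with `q` elements, under simultaneous conjugation. -/
noncomputable def Mcount (F : Type) [Field F] (g n : ℕ) : ℕ :=
  Nat.card {x : TupleOrbits F n g //
    ∃ v : MatTuple F n g, Quotient.mk _ v = x ∧ ∀ i, IsNilpotent (v i)}

/-- `I_g(n,q)`: the number of indecomposable orbits of `g`-tuples of nilpotent `n × n`
matrices over a finite field with `q` elements, under simultaneous conjugation. -/
noncomputable def Icount (F : Type) [Field F] (g n : ℕ) : ℕ :=
  Nat.card {x : TupleOrbits F n g //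
    ∃ v : MatTuple F n g, Quotient.mk _ v = x ∧ (∀ i, IsNilpotent (v i)) ∧
      ¬ IsDecomposableTuple v}

/-- `A_g(n,q)`: the number of absolutely indecomposable orbits of `g`-tuples of nilpotent
`n × n` matrices over a finite field with `q` elements. -/
noncomputable def Acount (F : Type) [Field F] (g n : ℕ) : ℕ :=
  Nat.card {x : TupleOrbits F n g //
    ∃ v : MatTuple F n g, Quotient.mk _ v = x ∧ (∀ i, IsNilpotent (v i)) ∧
      IsAbsIndecTuple v}

namespace NilpotentTuple

open Matrix

/-- Two tuples are conjugate if some invertible matrix intertwines them. -/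
def IsConjTuple {K : Type} [Field K] {n g : ℕ} (v w : MatTuple K n g) : Prop :=
  ∃ T : (Matrix (Fin n) (Fin n) K)ˣ, ∀ i, T.val * v i = w i * T.val

/-- No common right null vector pairs nontrivially with a common left null vector. -/
def IsNullOrthogonal {K : Type} [Field K] {n g : ℕ} (v : MatTuple K n g) : Prop :=
  ∀ x y : Fin n → K, (∀ i, v i *ᵥ x = 0) → (∀ i, y ᵥ* v i = 0) → y ⬝ᵥ x = 0

section General

variable {K : Type} [Field K] {n g : ℕ}

lemma IsConjTuple.trans {u v w : MatTuple K n g} (h₁ : IsConjTuple u v)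
    (h₂ : IsConjTuple v w) : IsConjTuple u w := by
  obtain ⟨S, hS⟩ := h₁
  obtain ⟨T, hT⟩ := h₂
  refine ⟨T * S, fun i => ?_⟩
  rw [Units.val_mul, mul_assoc, hS i, ← mul_assoc, hT i, mul_assoc]

lemma isConjTuple_conj (T : (Matrix (Fin n) (Fin n) K)ˣ) (v : MatTuple K n g) :
    IsConjTuple v (fun i => T.val * v i * (T⁻¹).val) :=
  ⟨T, fun i => by simp [mul_assoc]⟩

lemma IsConjTuple.eq_conj {v w : MatTuple K n g} {T : (Matrix (Fin n) (Fin n) K)ˣ}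
    (hT : ∀ i, T.val * v i = w i * T.val) (i : Fin g) :
    w i = T.val * v i * (T⁻¹).val := by
  rw [Units.eq_mul_inv_iff_mul_eq, hT i]

lemma mk_eq_mk_iff (v w : MatTuple K n g) :
    (Quotient.mk _ v : TupleOrbits K n g) = Quotient.mk _ w ↔ IsConjTuple w v := by
  rw [Quotient.eq, MulAction.orbitRel_apply, MulAction.mem_orbit_iff]
  constructor
  · rintro ⟨c, rfl⟩
    exact ⟨ConjAct.ofConjAct c, fun i => by simp [ConjAct.units_smul_def, mul_assoc]⟩
  · rintro ⟨T, hT⟩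
    refine ⟨ConjAct.toConjAct T, funext fun i => ?_⟩
    simp [ConjAct.units_smul_def, hT i, mul_assoc]

lemma IsConjTuple.pow_eq_zero_iff {v w : MatTuple K n g} (h : IsConjTuple v w)
    (i : Fin g) (k : ℕ) : v i ^ k = 0 ↔ w i ^ k = 0 := by
  obtain ⟨T, hT⟩ := h
  rw [IsConjTuple.eq_conj hT i, Units.conj_pow, Units.mul_left_eq_zero, Units.mul_right_eq_zero]

lemma IsConjTuple.isNilpotent {v w : MatTuple K n g} (h : IsConjTuple v w)
    (hv : ∀ i, IsNilpotent (v i)) (i : Fin g) : IsNilpotent (w i) := by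
  obtain ⟨k, hk⟩ := hv i
  exact ⟨k, (h.pow_eq_zero_iff i k).1 hk⟩

lemma IsConjTuple.isNullOrthogonal {v w : MatTuple K n g} (h : IsConjTuple v w)
    (hv : IsNullOrthogonal v) : IsNullOrthogonal w := by
  obtain ⟨T, hT⟩ := h
  intro x y hx hy
  have key := hv ((T⁻¹).val *ᵥ x) (y ᵥ* T.val) (fun i => ?_) (fun i => ?_)
  · rwa [← dotProduct_mulVec, mulVec_mulVec, Units.mul_inv, one_mulVec] at key
  · have h1 : v i * (T⁻¹).val = (T⁻¹).val * w i := by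
      rw [Units.mul_inv_eq_iff_eq_mul, mul_assoc, ← hT i, Units.inv_mul_cancel_left]
    rw [mulVec_mulVec, h1, ← mulVec_mulVec, hx i, mulVec_zero]
  · rw [vecMul_vecMul, hT i, ← vecMul_vecMul, hy i, zero_vecMul]

lemma IsConjTuple.isDecomposableTuple {v w : MatTuple K n g} (h : IsConjTuple v w)
    (hv : IsDecomposableTuple w) : IsDecomposableTuple v := by
  obtain ⟨S, hS⟩ := h
  obtain ⟨d₁, d₂, h₁, h₂, hd, T, A, B, hT⟩ := hv
  refine ⟨d₁, d₂, h₁, h₂, hd, S⁻¹ * T, A, B, fun i => ?_⟩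
  rw [← hT i, IsConjTuple.eq_conj hS i]
  simp [mul_assoc]

/-- The number of absolutely indecomposable nilpotent orbits is the size of any irredundant
system of representatives. -/
lemma Acount_eq_card {F ι : Type} [Field F] (f : ι → MatTuple F n g)
    (nil : ∀ a i, IsNilpotent (f a i)) (indec : ∀ a, IsAbsIndecTuple (f a))
    (inj : ∀ a b, IsConjTuple (f a) (f b) → a = b)
    (surj : ∀ v : MatTuple F n g, (∀ i, IsNilpotent (v i)) → IsAbsIndecTuple v →
      ∃ a, IsConjTuple v (f a)) :
    Acount F g n = Nat.card ι := by
  refine (Nat.card_eq_of_bijective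
    (fun a => (⟨Quotient.mk _ (f a), f a, rfl, nil a, indec a⟩ :
      {x : TupleOrbits F n g // ∃ v : MatTuple F n g, Quotient.mk _ v = x ∧
        (∀ i, IsNilpotent (v i)) ∧ IsAbsIndecTuple v})) ⟨?_, ?_⟩).symm
  · intro a b hab
    exact (inj _ _ ((mk_eq_mk_iff _ _).1 (congrArg Subtype.val hab))).symm
  · rintro ⟨_, v, rfl, hv, hv'⟩
    obtain ⟨a, ha⟩ := surj v hv hv'
    exact ⟨a, Subtype.ext ((mk_eq_mk_iff _ _).2 ha)⟩

/-- A nilpotent tuple with an isolated index has a null vector pairing nontrivially with a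
left null vector. -/
lemma not_isNullOrthogonal_of_isolated {w : MatTuple K n g} (hw : ∀ i, IsNilpotent (w i))
    (k : Fin n) (hk : ∀ i j, j ≠ k → w i j k = 0 ∧ w i k j = 0) :
    ¬ IsNullOrthogonal w := by
  have hcol : ∀ i, w i *ᵥ Pi.single k 1 = w i k k • Pi.single k 1 := by
    intro i
    ext j
    by_cases hj : j = k
    · subst hj; simp
    · simp [hj, (hk i j hj).1]
  have hzero : ∀ i, w i k k = 0 := by
    intro i
    obtain ⟨m, hm⟩ := hw i
    have hpow : ∀ m : ℕ, (w i ^ m) *ᵥ Pi.single k 1 = w i k k ^ m • Pi.single k 1 := by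
      intro m
      induction m with
      | zero => rw [pow_zero, pow_zero, one_mulVec, one_smul]
      | succ m ih => rw [pow_succ, ← mulVec_mulVec, hcol, mulVec_smul, ih, smul_smul, pow_succ']
    have := congrFun (hpow m) k
    rw [hm] at this
    exact eq_zero_of_pow_eq_zero (n := m) (by simpa using this.symm)
  intro h
  have := h (Pi.single k 1) (Pi.single k 1) (fun i => by rw [hcol, hzero, zero_smul]) (fun i => ?_)
  · simp at this
  · ext j
    by_cases hj : j = k
    · subst hj; simp [hzero]
    · simp [(hk i j hj).2]

/-- Tuples of nilpotent matrices of size at most three whose null spaces are orthogonal are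
indecomposable: one of the blocks of a decomposition would have size one. -/
lemma not_isDecomposableTuple {v : MatTuple K n g} (hn : n ≤ 3)
    (hv : ∀ i, IsNilpotent (v i)) (ho : IsNullOrthogonal v) : ¬ IsDecomposableTuple v := by
  rintro ⟨d₁, d₂, h₁, h₂, hd, T, A, B, hT⟩
  set e := finSumFinEquiv.trans (finCongr hd) with he
  have hc : IsConjTuple v (fun i => reindex e e (fromBlocks (A i) 0 0 (B i))) :=
    ⟨T⁻¹, fun i => by
      change _ = reindex e e _ * _
      rw [← hT i, mul_assoc _ T.val, Units.mul_inv, mul_one]⟩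
  have hd' : d₁ = 1 ∨ d₂ = 1 := by omega
  rcases hd' with rfl | rfl
  · refine not_isNullOrthogonal_of_isolated (hc.isNilpotent hv) (e (Sum.inl 0)) ?_
      (hc.isNullOrthogonal ho)
    intro i j hj
    obtain ⟨j, rfl⟩ := e.surjective j
    rcases j with j | j
    · exact absurd (by rw [Subsingleton.elim j 0]) hj
    · simp
  · refine not_isNullOrthogonal_of_isolated (hc.isNilpotent hv) (e (Sum.inr 0)) ?_
      (hc.isNullOrthogonal ho)
    intro i j hj
    obtain ⟨j, rfl⟩ := e.surjective j
    rcases j with j | j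
    · simp
    · exact absurd (by rw [Subsingleton.elim j 0]) hj

lemma isDecomposableTuple_of_isolated {m : ℕ} (hm : 0 < m) {w : MatTuple K (1 + m) g}
    (hk : ∀ i j, j ≠ 0 → w i j 0 = 0 ∧ w i 0 j = 0) : IsDecomposableTuple w := by
  set e := (finSumFinEquiv (m := 1) (n := m)).trans (finCongr rfl) with he
  have he0 : ∀ a : Fin 1, e (Sum.inl a) = 0 := by
    intro a; rw [Subsingleton.elim a 0]; rfl
  have he1 : ∀ b : Fin m, e (Sum.inr b) ≠ 0 := by
    intro b hb
    rw [← he0 0] at hb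
    simpa using e.injective hb
  refine ⟨1, m, one_pos, hm, rfl, 1, fun i => ((w i).submatrix e e).toBlocks₁₁,
    fun i => ((w i).submatrix e e).toBlocks₂₂, fun i => ?_⟩
  have h12 : ((w i).submatrix e e).toBlocks₁₂ = 0 := by
    ext a b; simp [toBlocks₁₂, he0, (hk i _ (he1 b)).2]
  have h21 : ((w i).submatrix e e).toBlocks₂₁ = 0 := by
    ext a b; simp [toBlocks₂₁, he0, (hk i _ (he1 a)).1]
  have := fromBlocks_toBlocks ((w i).submatrix e e)
  rw [h12, h21] at this
  rw [this, ← he, reindex_apply, submatrix_submatrix]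
  simp

/-- A common null vector pairing nontrivially with a common left null vector splits off a
one-dimensional summand. -/
lemma isNullOrthogonal_of_not_isDecomposableTuple {v : MatTuple K 3 g}
    (hv : ¬ IsDecomposableTuple v) : IsNullOrthogonal v := by
  intro x y hx hy
  by_contra hxy
  have hT : ∃ T : (Matrix (Fin 3) (Fin 3) K)ˣ,
      T.val *ᵥ Pi.single 0 1 = x ∧ y ᵥ* T.val = (y ⬝ᵥ x) • Pi.single 0 1 := by
    suffices ∃ T : Matrix (Fin 3) (Fin 3) K, T.det ≠ 0 ∧
        T *ᵥ Pi.single 0 1 = x ∧ y ᵥ* T = (y ⬝ᵥ x) • Pi.single 0 1 by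
      obtain ⟨T, h0, h1, h2⟩ := this
      exact ⟨((isUnit_iff_isUnit_det T).2 h0.isUnit).unit, h1, h2⟩
    have hy0 : y 0 ≠ 0 ∨ y 1 ≠ 0 ∨ y 2 ≠ 0 := by
      by_contra! h
      exact hxy (by simp [dotProduct, Fin.sum_univ_three, h.1, h.2.1, h.2.2])
    simp only [dotProduct, Fin.sum_univ_three] at hxy ⊢
    rcases hy0 with h | h | h
    · refine ⟨!![x 0, -y 1, -y 2; x 1, y 0, 0; x 2, 0, y 0], ?_, ?_, ?_⟩
      · rw [det_fin_three]; simp; grind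
      · ext i; fin_cases i <;> simp
      · ext i; fin_cases i <;> simp [vecMul, dotProduct, Fin.sum_univ_three] <;> ring
    · refine ⟨!![x 0, y 1, 0; x 1, -y 0, -y 2; x 2, 0, y 1], ?_, ?_, ?_⟩
      · rw [det_fin_three]; simp; grind
      · ext i; fin_cases i <;> simp
      · ext i; fin_cases i <;> simp [vecMul, dotProduct, Fin.sum_univ_three] <;> ring
    · refine ⟨!![x 0, y 2, 0; x 1, 0, y 2; x 2, -y 0, -y 1], ?_, ?_, ?_⟩
      · rw [det_fin_three]; simp; grind
      · ext i; fin_cases i <;> simp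
      · ext i; fin_cases i <;> simp [vecMul, dotProduct, Fin.sum_univ_three] <;> ring
  obtain ⟨T, hTx, hTy⟩ := hT
  apply hv
  refine (isConjTuple_conj T⁻¹ v).isDecomposableTuple
    (isDecomposableTuple_of_isolated (m := 2) two_pos fun i j hj => ⟨?_, ?_⟩)
  · have : ((T⁻¹).val * v i * (T⁻¹⁻¹).val) *ᵥ Pi.single 0 1 = 0 := by
      rw [inv_inv, ← mulVec_mulVec, hTx, ← mulVec_mulVec, hx i, mulVec_zero]
    simpa using congrFun this j
  · have hrow : (Pi.single 0 1 : Fin 3 → K) ᵥ* (T⁻¹).val = (y ⬝ᵥ x)⁻¹ • y := by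
      have : y = (y ⬝ᵥ x) • ((Pi.single 0 1 : Fin 3 → K) ᵥ* (T⁻¹).val) := by
        rw [← smul_vecMul, ← hTy, vecMul_vecMul, Units.mul_inv, vecMul_one]
      conv_rhs => rw [this]
      rw [smul_smul, ← this, inv_mul_cancel₀ hxy, one_smul]
    have : (Pi.single 0 1 : Fin 3 → K) ᵥ* ((T⁻¹).val * v i * (T⁻¹⁻¹).val) = 0 := by
      rw [← vecMul_vecMul, ← vecMul_vecMul, hrow, smul_vecMul, hy i, smul_zero, zero_vecMul]
    simpa using congrFun this j

lemma isNullOrthogonal_of_map {L : Type} [Field L] (f : K →+* L) {v : MatTuple K n g}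
    (h : IsNullOrthogonal fun i => (v i).map f) : IsNullOrthogonal v := by
  intro x y hx hy
  have := h (f ∘ x) (f ∘ y)
    (fun i => by ext j; rw [← RingHom.map_mulVec, hx i]; simp)
    (fun i => by ext j; rw [← RingHom.map_vecMul, hy i]; simp)
  rw [← RingHom.map_dotProduct] at this
  exact f.injective (by simpa using this)

lemma isAbsIndecTuple_of_isNullOrthogonal {v : MatTuple K n g} (hn : n ≤ 3)
    (hv : ∀ i, IsNilpotent (v i))
    (ho : IsNullOrthogonal fun i => (v i).map (algebraMap K (AlgebraicClosure K))) :
    IsAbsIndecTuple v :=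
  not_isDecomposableTuple hn
    (fun i => (hv i).map (algebraMap K (AlgebraicClosure K)).mapMatrix) ho

lemma isNullOrthogonal_of_isAbsIndecTuple {v : MatTuple K 3 g} (h : IsAbsIndecTuple v) :
    IsNullOrthogonal v :=
  isNullOrthogonal_of_map _ (isNullOrthogonal_of_not_isDecomposableTuple h)

end General

section Three

variable {K : Type} [Field K]

/-- The nilpotent Jordan block of size three. -/
def jordanThree (K : Type) [Field K] : Matrix (Fin 3) (Fin 3) K :=
  !![0, 1, 0; 0, 0, 1; 0, 0, 0]

lemma pow_three_eq_zero_of_isNilpotent {M : Matrix (Fin 3) (Fin 3) K} (h : IsNilpotent M) :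
    M ^ 3 = 0 := by
  have := aeval_self_charpoly M
  rw [(isNilpotent_charpoly_sub_pow_of_isNilpotent h).eq_zero |> sub_eq_zero.1] at this
  simpa using this

lemma cayley_hamilton_three (M : Matrix (Fin 3) (Fin 3) K) :
    M ^ 3 = M.trace • M ^ 2 - (M 0 0 * M 1 1 - M 0 1 * M 1 0 + M 0 0 * M 2 2 - M 0 2 * M 2 0
      + M 1 1 * M 2 2 - M 1 2 * M 2 1) • M + M.det • 1 := by
  ext i j
  fin_cases i <;> fin_cases j <;>
    simp [pow_succ, mul_apply, Fin.sum_univ_three, trace, det_fin_three] <;> ring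

/-- The coefficients of the characteristic polynomial of a nilpotent matrix vanish. -/
lemma charpoly_coeffs_of_isNilpotent {M : Matrix (Fin 3) (Fin 3) K} (h : IsNilpotent M) :
    M 0 0 + M 1 1 + M 2 2 = 0 ∧
    M 0 0 * M 1 1 - M 0 1 * M 1 0 + M 0 0 * M 2 2 - M 0 2 * M 2 0
      + M 1 1 * M 2 2 - M 1 2 * M 2 1 = 0 ∧
    M 0 0 * M 1 1 * M 2 2 - M 0 0 * M 1 2 * M 2 1 - M 0 1 * M 1 0 * M 2 2
      + M 0 1 * M 1 2 * M 2 0 + M 0 2 * M 1 0 * M 2 1 - M 0 2 * M 1 1 * M 2 0 = 0 := by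
  have ht : M.trace = 0 := (isNilpotent_trace_of_isNilpotent h).eq_zero
  have hd : M.det = 0 := by
    have := congrArg det (pow_three_eq_zero_of_isNilpotent h)
    rw [det_pow, det_zero] at this
    exact eq_zero_of_pow_eq_zero this
  have hc := cayley_hamilton_three M
  rw [pow_three_eq_zero_of_isNilpotent h, ht, hd] at hc
  refine ⟨by simpa [trace, Fin.sum_univ_three] using ht, ?_, by rwa [det_fin_three] at hd⟩
  simp only [zero_smul, zero_sub, add_zero, zero_eq_neg, smul_eq_zero] at hc
  rcases hc with hc | rfl
  · exact hc
  · simp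

/-- A cyclic covector brings a nilpotent matrix with nonzero square to Jordan form. -/
lemma exists_intertwine_jordanThree {M : Matrix (Fin 3) (Fin 3) K} (h : IsNilpotent M)
    (h2 : M ^ 2 ≠ 0) :
    ∃ T : (Matrix (Fin 3) (Fin 3) K)ˣ, T.val * M = jordanThree K * T.val := by
  have h3 := pow_three_eq_zero_of_isNilpotent h
  obtain ⟨k, hk⟩ : ∃ k, (M ^ 2) k ≠ 0 := by
    by_contra! hc
    exact h2 (funext hc)
  set T : Matrix (Fin 3) (Fin 3) K := of ![(1 : Matrix (Fin 3) (Fin 3) K) k, M k, (M ^ 2) k]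
    with hT
  have hTM : T * M = jordanThree K * T := by
    have hsq : (M ^ 3) k = 0 := by rw [h3]; rfl
    have hrow : ∀ A : Matrix (Fin 3) (Fin 3) K, A k ᵥ* M = (A * M) k := fun A => rfl
    ext i j
    fin_cases i
    · have : ((1 : Matrix (Fin 3) (Fin 3) K) * M) k j = M k j := by rw [one_mul]
      rw [mul_apply] at this
      simpa [jordanThree, mul_apply, Fin.sum_univ_three, hT] using this
    · have := congrFun (hrow M) j
      simp [jordanThree, mul_apply, Fin.sum_univ_three, hT, vecMul, dotProduct, pow_two] at this ⊢
    · have := congrFun (hrow (M ^ 2)) j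
      rw [← pow_succ, hsq] at this
      simpa [jordanThree, mul_apply, Fin.sum_univ_three, hT, vecMul, dotProduct] using this
  have hu : IsUnit T := by
    rw [isUnit_iff_isUnit_det, isUnit_iff_ne_zero]
    intro hdet
    obtain ⟨v, hv0, hv⟩ := exists_vecMul_eq_zero_iff.2 hdet
    have hshift : ∀ u : Fin 3 → K, u ᵥ* T = 0 → ![0, u 0, u 1] ᵥ* T = 0 := by
      intro u hu
      have : u ᵥ* jordanThree K = ![0, u 0, u 1] := by
        ext i
        fin_cases i <;> simp [jordanThree, vecMul, dotProduct, Fin.sum_univ_three]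
      rw [← this, vecMul_vecMul, ← hTM, ← vecMul_vecMul, hu, zero_vecMul]
    have hlast : ∀ c : K, ![0, 0, c] ᵥ* T = 0 → c = 0 := by
      intro c hc
      obtain ⟨j, hj⟩ := Function.ne_iff.1 hk
      have : c = 0 ∨ (M ^ 2) k j = 0 := by
        simpa [vecMul, dotProduct, Fin.sum_univ_three, hT] using congrFun hc j
      exact this.resolve_right hj
    have h0 : v 0 = 0 := hlast _ (by simpa using hshift _ (hshift _ hv))
    have h1 : v 1 = 0 := hlast _ (by simpa [h0] using hshift _ hv)
    have hv' : v = ![0, 0, v 2] := by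
      ext i
      fin_cases i <;> simp [h0, h1]
    have h2' : v 2 = 0 := hlast _ (by rwa [← hv'])
    exact hv0 (by rw [hv', h2']; ext i; fin_cases i <;> rfl)
  exact ⟨hu.unit, hTM⟩

/-- A nonzero square-zero matrix is conjugate to a matrix unit. -/
lemma exists_intertwine_single {M : Matrix (Fin 3) (Fin 3) K} (h0 : M ≠ 0) (h2 : M ^ 2 = 0) :
    ∃ T : (Matrix (Fin 3) (Fin 3) K)ˣ, T.val * M = single 0 2 1 * T.val := by
  obtain ⟨ht, he, -⟩ := charpoly_coeffs_of_isNilpotent (M := M) ⟨2, h2⟩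
  have hsq : ∀ i j, M i 0 * M 0 j + M i 1 * M 1 j + M i 2 * M 2 j = 0 := by
    intro i j
    simpa [pow_two, mul_apply, Fin.sum_univ_three] using congrFun (congrFun h2 i) j
  suffices ∃ T : Matrix (Fin 3) (Fin 3) K, T.det ≠ 0 ∧ T * M = single 0 2 1 * T by
    obtain ⟨T, h0, h1⟩ := this
    exact ⟨((isUnit_iff_isUnit_det T).2 h0.isUnit).unit, h1⟩
  obtain ⟨i, j, k, hij, hM⟩ : ∃ i j k : Fin 3, ({i, j, k} : Finset (Fin 3)) = Finset.univ ∧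
      M i j ≠ 0 := by
    by_contra! hc
    have h01 := hc 0 1 2 (by decide)
    have h02 := hc 0 2 1 (by decide)
    have h10 := hc 1 0 2 (by decide)
    have h12 := hc 1 2 0 (by decide)
    have h20 := hc 2 0 1 (by decide)
    have h21 := hc 2 1 0 (by decide)
    have h00 := hsq 0 0
    have h11 := hsq 1 1
    have h22 := hsq 2 2
    apply h0
    ext i j
    fin_cases i <;> fin_cases j <;> simp_all
  refine ⟨of ![Pi.single i 1, M i j • Pi.single k 1 - M k j • Pi.single i 1, M i], ?_, ?_⟩
  · have := pow_ne_zero 2 hM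
    rw [det_fin_three]
    fin_cases i <;> fin_cases j <;> fin_cases k <;> first | exact absurd hij (by decide) |
      (simp at this hM ⊢; grind)
  · have hs : ∀ j, M i 0 * M 0 j + M i 1 * M 1 j + M i 2 * M 2 j = 0 := hsq i
    ext a b
    fin_cases a
    · simp [mul_apply, single, Pi.single_apply]
    · have hr : M i j * M k b = M k j * M i b := by
        have h00 := hsq 0 0
        have h01 := hsq 0 1
        have h02 := hsq 0 2
        have h10 := hsq 1 0
        have h11 := hsq 1 1
        have h12 := hsq 1 2
        have h20 := hsq 2 0
        have h21 := hsq 2 1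
        have h22 := hsq 2 2
        clear hsq hM hs h2 h0
        fin_cases i <;> fin_cases j <;> fin_cases k <;> first | exact absurd hij (by decide) |
          (clear hij; fin_cases b <;> grind)
      simp [mul_apply, single, Pi.single_apply, sub_mul, Finset.sum_sub_distrib, hr]
    · simpa [mul_apply, Fin.sum_univ_three, single] using hs b

/-- The normal form for nilpotent matrices under conjugation by the centralizer of the Jordan
block. -/
def IsJordanReduced (A : Matrix (Fin 3) (Fin 3) K) : Prop :=
  (A 2 0 ≠ 0 → A 1 0 = 0 ∧ A 0 0 = 0) ∧
  (A 2 0 = 0 → A 1 0 ≠ 0 → A 0 0 = 0 ∧ A 1 2 = 0) ∧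
  (A 2 0 = 0 → A 1 0 = 0 → A 2 1 ≠ 0 → A 2 2 = 0 ∧ A 0 1 = 0) ∧
  (A 2 0 = 0 → A 1 0 = 0 → A 2 1 = 0 →
    A 0 0 = 0 ∧ A 1 1 = 0 ∧ A 2 2 = 0 ∧ (A 0 1 ≠ A 1 2 → A 0 2 = 0))

/-- The invertible element `1 + bN + cN²` of the centralizer of the Jordan block `N`. -/
def jordanCentralizer (b c : K) : (Matrix (Fin 3) (Fin 3) K)ˣ where
  val := !![1, b, c; 0, 1, b; 0, 0, 1]
  inv := !![1, -b, b ^ 2 - c; 0, 1, -b; 0, 0, 1]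
  val_inv := by
    ext i j; fin_cases i <;> fin_cases j <;> simp [mul_apply, Fin.sum_univ_three] ; ring
  inv_val := by
    ext i j; fin_cases i <;> fin_cases j <;> simp [mul_apply, Fin.sum_univ_three] ; ring

lemma jordanCentralizer_comm (b c : K) :
    (jordanCentralizer b c).val * jordanThree K = jordanThree K * (jordanCentralizer b c).val := by
  ext i j
  fin_cases i <;> fin_cases j <;>
    simp [jordanCentralizer, jordanThree, mul_apply, Fin.sum_univ_three]

lemma exists_isJordanReduced {M : Matrix (Fin 3) (Fin 3) K} (h : IsNilpotent M) :
    ∃ b c : K, IsJordanReduced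
      ((jordanCentralizer b c).val * M * (jordanCentralizer b c)⁻¹.val) := by
  obtain ⟨ht, he, hd⟩ := charpoly_coeffs_of_isNilpotent h
  have hval : ∀ b c : K, (jordanCentralizer b c).val =
    !![1, b, c; 0, 1, b; 0, 0, 1] := fun _ _ => rfl
  have hinv : ∀ b c : K, ((jordanCentralizer b c)⁻¹).val =
    !![1, -b, b ^ 2 - c; 0, 1, -b; 0, 0, 1] := fun _ _ => rfl
  simp only [hval, hinv, IsJordanReduced, mul_apply, Fin.sum_univ_three]
  simp only [of_apply, cons_val', cons_val_zero, cons_val_one, cons_val, one_mul, zero_mul,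
    mul_one, mul_zero, add_zero, zero_add]
  clear hval hinv h
  by_cases h20 : M 2 0 = 0
  · by_cases h10 : M 1 0 = 0
    · by_cases h21 : M 2 1 = 0
      · by_cases h12 : M 0 1 = M 1 2
        · refine ⟨0, 0, ?_⟩
          grind
        · refine ⟨M 0 2 / (M 0 1 - M 1 2), 0, ?_⟩
          have : M 0 1 - M 1 2 ≠ 0 := sub_ne_zero.2 h12
          grind
      · refine ⟨M 2 2 / M 2 1, (M 2 2 / M 2 1 * M 0 0 - M 0 1 - M 2 2 / M 2 1 * M 1 1) / M 2 1, ?_⟩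
        grind
    · generalize hb : -M 0 0 / M 1 0 = b
      refine ⟨b, b ^ 2 + (M 1 2 + b * M 2 2 - b * (M 1 1 + b * M 2 1)) / M 1 0, ?_⟩
      grind
  · generalize hb : -M 1 0 / M 2 0 = b
    refine ⟨b, -(M 0 0 + b * M 1 0) / M 2 0, ?_⟩
    grind

lemma mul_eq_of_comm_jordanThree (T : (Matrix (Fin 3) (Fin 3) K)ˣ)
    (h : T.val * jordanThree K = jordanThree K * T.val) :
    T.val 0 0 ≠ 0 ∧ T.val = !![T.val 0 0, T.val 0 1, T.val 0 2; 0, T.val 0 0, T.val 0 1;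
      0, 0, T.val 0 0] := by
  have he : ∀ i j, (T.val * jordanThree K) i j = (jordanThree K * T.val) i j := by
    intro i j; rw [h]
  have hT : T.val = !![T.val 0 0, T.val 0 1, T.val 0 2; 0, T.val 0 0, T.val 0 1;
      0, 0, T.val 0 0] := by
    have h00 := he 0 0
    have h01 := he 0 1
    have h02 := he 0 2
    have h10 := he 1 0
    have h11 := he 1 1
    have h12 := he 1 2
    have h20 := he 2 0
    have h21 := he 2 1
    have h22 := he 2 2
    simp [jordanThree, mul_apply, Fin.sum_univ_three] at h00 h01 h02 h10 h11 h12 h20 h21 h22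
    ext i j
    fin_cases i <;> fin_cases j <;> simp <;> grind
  refine ⟨fun h0 => ?_, hT⟩
  have hdet := ((isUnit_iff_isUnit_det T.val).1 T.isUnit).ne_zero
  rw [hT, det_fin_three] at hdet
  simp [h0] at hdet

lemma IsJordanReduced.eq_of_intertwine {A B : Matrix (Fin 3) (Fin 3) K}
    (hA : IsJordanReduced A) (hB : IsJordanReduced B) (T : (Matrix (Fin 3) (Fin 3) K)ˣ)
    (hN : T.val * jordanThree K = jordanThree K * T.val) (hT : T.val * A = B * T.val) :
    A = B := by
  obtain ⟨h0, hT'⟩ := mul_eq_of_comm_jordanThree T hN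
  generalize T.val 0 0 = a at *
  generalize T.val 0 1 = b at *
  generalize T.val 0 2 = c at *
  rw [hT'] at hT
  have he : ∀ i j, (!![a, b, c; 0, a, b; 0, 0, a] * A) i j =
      (B * !![a, b, c; 0, a, b; 0, 0, a]) i j := by
    intro i j; rw [hT]
  have h00 := he 0 0
  have h01 := he 0 1
  have h02 := he 0 2
  have h10 := he 1 0
  have h11 := he 1 1
  have h12 := he 1 2
  have h20 := he 2 0
  have h21 := he 2 1
  have h22 := he 2 2
  simp only [mul_apply, Fin.sum_univ_three, of_apply, cons_val', cons_val_zero, cons_val_one,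
    cons_val, zero_mul, mul_zero, add_zero, zero_add] at h00 h01 h02 h10 h11 h12 h20 h21 h22
  have e20 : A 2 0 = B 2 0 := mul_left_cancel₀ h0 (by linear_combination h20)
  unfold IsJordanReduced at hA hB
  obtain ⟨hA1, hA2, hA3, hA4⟩ := hA
  obtain ⟨hB1, hB2, hB3, hB4⟩ := hB
  clear hT hT' he hN
  have hscalar : b = 0 → c = 0 → A = B := by
    rintro rfl rfl
    ext i j
    refine mul_left_cancel₀ h0 ?_
    fin_cases i <;> fin_cases j <;> simp <;> grind
  by_cases z20 : A 2 0 = 0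
  · have e10 : A 1 0 = B 1 0 := mul_left_cancel₀ h0 (by grind)
    have e21 : A 2 1 = B 2 1 := mul_left_cancel₀ h0 (by grind)
    by_cases z10 : A 1 0 = 0
    · by_cases z21 : A 2 1 = 0
      · have e01 : A 0 1 = B 0 1 := mul_left_cancel₀ h0 (by grind)
        have e12 : A 1 2 = B 1 2 := mul_left_cancel₀ h0 (by grind)
        have e02 : A 0 2 = B 0 2 := by
          by_cases hne : A 0 1 = A 1 2
          · exact mul_left_cancel₀ h0 (by grind)
          · grind
        ext i j
        fin_cases i <;> fin_cases j <;> simp <;> grind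
      · have hb : b = 0 := by grind
        exact hscalar hb (by grind)
    · have hb : b = 0 := by grind
      exact hscalar hb (by grind)
  · have hb : b = 0 := by grind
    exact hscalar hb (by grind)

/-- Parameters of the reduced nilpotent matrices. -/
abbrev ReducedIndex (K : Type) [Field K] : Type :=
  (Kˣ × Kˣ × K × K) ⊕ (Kˣ × K × K) ⊕ (Kˣ × Kˣ × K) ⊕ (Kˣ × K) ⊕ (Kˣ × K) ⊕ (K × Kˣ) ⊕ (K × K)

/-- The reduced nilpotent matrix with given parameters. -/
def reducedMatrix : ReducedIndex K → Matrix (Fin 3) (Fin 3) K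
  | .inl (f, e, d, g) =>
    !![0, -(d ^ 2 + e * g) / f * d / e, -(d ^ 2 + e * g) / f; 0, d, e; f, g, -d]
  | .inr (.inl (f, a, g)) => !![0, a, 0; 0, 0, 0; f, g, 0]
  | .inr (.inr (.inl (s, g, d))) => !![0, -d ^ 2 / s, d ^ 3 / (s * g); s, d, 0; 0, g, -d]
  | .inr (.inr (.inr (.inl (s, b)))) => !![0, 0, b; s, 0, 0; 0, 0, 0]
  | .inr (.inr (.inr (.inr (.inl (t, y))))) => !![0, 0, y; 0, 0, 0; 0, t, 0]
  | .inr (.inr (.inr (.inr (.inr (.inl (x, z)))))) => !![0, x, 0; 0, 0, x + z; 0, 0, 0]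
  | .inr (.inr (.inr (.inr (.inr (.inr (x, y)))))) => !![0, x, y; 0, 0, x; 0, 0, 0]

lemma reducedMatrix_injective : Function.Injective (reducedMatrix (K := K)) := by
  intro a b h
  have e01 := congrFun (congrFun h 0) 1
  have e02 := congrFun (congrFun h 0) 2
  have e11 := congrFun (congrFun h 1) 1
  have e12 := congrFun (congrFun h 1) 2
  have e10 := congrFun (congrFun h 1) 0
  have e20 := congrFun (congrFun h 2) 0
  have e21 := congrFun (congrFun h 2) 1
  clear h
  rcases a with ⟨a1, a2, a3, a4⟩ | ⟨a1, a2, a3⟩ | ⟨a1, a2, a3⟩ | ⟨a1, a2⟩ | ⟨a1, a2⟩ |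
    ⟨a1, a2⟩ | ⟨a1, a2⟩ <;>
  rcases b with ⟨b1, b2, b3, b4⟩ | ⟨b1, b2, b3⟩ | ⟨b1, b2, b3⟩ | ⟨b1, b2⟩ | ⟨b1, b2⟩ |
    ⟨b1, b2⟩ | ⟨b1, b2⟩ <;>
  simp [reducedMatrix, Units.val_inj] at e01 e02 e11 e12 e10 e20 e21 ⊢
  all_goals first
    | exact b1.ne_zero e20.symm
    | exact b1.ne_zero e10.symm
    | exact b1.ne_zero e21.symm
    | exact b2.ne_zero e12.symm
    | exact b2.ne_zero e21.symm
    | exact ⟨e01, Units.ext (add_left_cancel (e12.trans (by rw [e01])))⟩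
    | exact a2.ne_zero (add_eq_left.1 (e12.trans e01.symm))
    | simp_all

lemma isJordanReduced_reducedMatrix (a : ReducedIndex K) : IsJordanReduced (reducedMatrix a) := by
  unfold IsJordanReduced
  rcases a with ⟨f, e, d, g⟩ | ⟨f, a, g⟩ | ⟨s, g, d⟩ | ⟨s, b⟩ | ⟨t, y⟩ | ⟨x, z⟩ | ⟨x, y⟩ <;>
    simp [reducedMatrix]

lemma isNilpotent_reducedMatrix (a : ReducedIndex K) : IsNilpotent (reducedMatrix a) := by
  refine ⟨3, ?_⟩
  ext i j
  rcases a with ⟨f, e, d, g⟩ | ⟨f, a, g⟩ | ⟨s, g, d⟩ | ⟨s, b⟩ | ⟨t, y⟩ | ⟨x, z⟩ | ⟨x, y⟩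
  · have hf := f.ne_zero
    have he := e.ne_zero
    fin_cases i <;> fin_cases j <;>
      simp [reducedMatrix, pow_succ, mul_apply, Fin.sum_univ_three] <;> field_simp <;> ring
  · fin_cases i <;> fin_cases j <;>
      simp [reducedMatrix, pow_succ, mul_apply, Fin.sum_univ_three]
  · have hs := s.ne_zero
    have hg := g.ne_zero
    fin_cases i <;> fin_cases j <;>
      simp [reducedMatrix, pow_succ, mul_apply, Fin.sum_univ_three] <;> field_simp <;> ring
  all_goals
    fin_cases i <;> fin_cases j <;>
      simp [reducedMatrix, pow_succ, mul_apply, Fin.sum_univ_three]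

lemma IsJordanReduced.exists_eq_reducedMatrix {M : Matrix (Fin 3) (Fin 3) K}
    (hM : IsJordanReduced M) (h : IsNilpotent M) : ∃ a, reducedMatrix a = M := by
  obtain ⟨ht, he, hd⟩ := charpoly_coeffs_of_isNilpotent h
  clear h
  obtain ⟨h1, h2, h3, h4⟩ := hM
  by_cases h20 : M 2 0 = 0
  · by_cases h10 : M 1 0 = 0
    · by_cases h21 : M 2 1 = 0
      · by_cases h12 : M 0 1 = M 1 2
        · refine ⟨.inr (.inr (.inr (.inr (.inr (.inr (M 0 1, M 0 2)))))), ?_⟩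
          ext i j
          fin_cases i <;> fin_cases j <;> simp [reducedMatrix] <;> grind
        · refine ⟨.inr (.inr (.inr (.inr (.inr (.inl (M 0 1,
            Units.mk0 (M 1 2 - M 0 1) (sub_ne_zero.2 (Ne.symm h12)))))))), ?_⟩
          ext i j
          fin_cases i <;> fin_cases j <;> simp [reducedMatrix] <;> grind
      · refine ⟨.inr (.inr (.inr (.inr (.inl (Units.mk0 _ h21, M 0 2))))), ?_⟩
        obtain ⟨h22, h01⟩ := h3 h20 h10 h21
        have h00 : M 0 0 = 0 := by grind
        have h11 : M 1 1 = 0 := by grind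
        ext i j
        fin_cases i <;> fin_cases j <;> simp [reducedMatrix] <;> grind
    · obtain ⟨h00, h12⟩ := h2 h20 h10
      have h01 : M 0 1 = -M 1 1 ^ 2 / M 1 0 := by grind
      have h22 : M 2 2 = -M 1 1 := by grind
      by_cases h21 : M 2 1 = 0
      · refine ⟨.inr (.inr (.inr (.inl (Units.mk0 _ h10, M 0 2)))), ?_⟩
        have h11 : M 1 1 = 0 := by
          rw [h20, h21, h00, h12] at hd
          have : M 1 1 ^ 3 = 0 := by grind
          exact eq_zero_of_pow_eq_zero this
        ext i j
        fin_cases i <;> fin_cases j <;> simp [reducedMatrix] <;> grind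
      · refine ⟨.inr (.inr (.inl (Units.mk0 _ h10, Units.mk0 _ h21, M 1 1))), ?_⟩
        have h02 : M 0 2 = M 1 1 ^ 3 / (M 1 0 * M 2 1) := by
          rw [eq_div_iff (mul_ne_zero h10 h21)]
          grind
        ext i j
        fin_cases i <;> fin_cases j <;> simp [reducedMatrix] <;> grind
  · obtain ⟨h10, h00⟩ := h1 h20
    have h22 : M 2 2 = -M 1 1 := by grind
    have h02 : M 0 2 = -(M 1 1 ^ 2 + M 1 2 * M 2 1) / M 2 0 := by grind
    have hdet : M 0 1 * M 1 2 = M 0 2 * M 1 1 := by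
      apply mul_right_cancel₀ h20
      grind
    by_cases h12 : M 1 2 = 0
    · refine ⟨.inr (.inl (Units.mk0 _ h20, M 0 1, M 2 1)), ?_⟩
      have h11 : M 1 1 = 0 := by
        have : M 1 1 ^ 3 = 0 := by grind
        exact eq_zero_of_pow_eq_zero this
      ext i j
      fin_cases i <;> fin_cases j <;> simp [reducedMatrix] <;> grind
    · refine ⟨.inl (Units.mk0 _ h20, Units.mk0 _ h12, M 1 1, M 2 1), ?_⟩
      have h01 : M 0 1 = M 0 2 * M 1 1 / M 1 2 := by rw [eq_div_iff h12, hdet]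
      ext i j
      fin_cases i <;> fin_cases j <;> simp [reducedMatrix] <;> grind

/-- Parameters of the reduced square-zero matrices. -/
abbrev SquareZeroIndex (K : Type) [Field K] : Type :=
  (Kˣ × K) ⊕ Kˣ ⊕ Kˣ ⊕ Kˣ ⊕ Kˣ ⊕ K

/-- The square-zero reduced matrices among all reduced nilpotent matrices. -/
def SquareZeroIndex.toReduced : SquareZeroIndex K → ReducedIndex K
  | .inl (f, g) => .inr (.inl (f, 0, g))
  | .inr (.inl s) => .inr (.inr (.inr (.inl (s, 0))))
  | .inr (.inr (.inl t)) => .inr (.inr (.inr (.inr (.inl (t, 0)))))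
  | .inr (.inr (.inr (.inl x))) => .inr (.inr (.inr (.inr (.inr (.inl (x, -x))))))
  | .inr (.inr (.inr (.inr (.inl z)))) => .inr (.inr (.inr (.inr (.inr (.inl (0, z))))))
  | .inr (.inr (.inr (.inr (.inr y)))) => .inr (.inr (.inr (.inr (.inr (.inr (0, y))))))

lemma SquareZeroIndex.toReduced_injective :
    Function.Injective (SquareZeroIndex.toReduced (K := K)) := by
  rintro (⟨f, g⟩ | s | t | x | z | y) (⟨f', g'⟩ | s' | t' | x' | z' | y') h <;>
    simp_all [SquareZeroIndex.toReduced]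
  exact x'.ne_zero h.1.symm

lemma SquareZeroIndex.sq_eq_zero (a : SquareZeroIndex K) : reducedMatrix a.toReduced ^ 2 = 0 := by
  rcases a with ⟨f, g⟩ | s | t | x | z | y <;>
  · ext i j
    fin_cases i <;> fin_cases j <;>
      simp [reducedMatrix, SquareZeroIndex.toReduced, pow_two, mul_apply, Fin.sum_univ_three]

lemma exists_toReduced_eq {a : ReducedIndex K} (h : reducedMatrix a ^ 2 = 0) :
    ∃ b : SquareZeroIndex K, b.toReduced = a := by
  have he : ∀ i j, (reducedMatrix a * reducedMatrix a) i j = 0 := by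
    intro i j; rw [← pow_two, h]; rfl
  simp only [mul_apply, Fin.sum_univ_three] at he
  rcases a with ⟨f, e, d, g⟩ | ⟨f, a, g⟩ | ⟨s, g, d⟩ | ⟨s, b⟩ | ⟨t, y⟩ | ⟨x, z⟩ | ⟨x, y⟩
  · have := he 1 0
    simp [reducedMatrix] at this
  · have := he 2 1
    simp [reducedMatrix] at this
    exact ⟨.inl (f, g), by simp [SquareZeroIndex.toReduced, this]⟩
  · have := he 2 0
    simp [reducedMatrix] at this
  · have := he 1 2
    simp [reducedMatrix] at this
    exact ⟨.inr (.inl s), by simp [SquareZeroIndex.toReduced, this]⟩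
  · have := he 0 1
    simp [reducedMatrix] at this
    exact ⟨.inr (.inr (.inl t)), by simp [SquareZeroIndex.toReduced, this]⟩
  · have := he 0 2
    simp [reducedMatrix] at this
    rcases this with rfl | hx
    · exact ⟨.inr (.inr (.inr (.inr (.inl z)))), rfl⟩
    · obtain rfl : x = ((-z : Kˣ) : K) := by simpa using eq_neg_of_add_eq_zero_left hx
      exact ⟨.inr (.inr (.inr (.inl (-z)))), by simp [SquareZeroIndex.toReduced]⟩
  · have := he 0 2
    simp [reducedMatrix] at this
    exact ⟨.inr (.inr (.inr (.inr (.inr y)))), by simp [SquareZeroIndex.toReduced, this]⟩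

lemma jordanThree_sq_ne_zero : jordanThree K ^ 2 ≠ 0 := by
  intro h
  have := congrFun (congrFun h 0) 2
  simp [jordanThree, pow_two] at this

lemma isNilpotent_jordanThree : IsNilpotent (jordanThree K) := by
  refine ⟨3, ?_⟩
  ext i j
  fin_cases i <;> fin_cases j <;> simp [jordanThree, pow_succ]

lemma isNullOrthogonal_of_jordanThree {g : ℕ} {v : MatTuple K 3 g} (i : Fin g)
    (hi : v i = jordanThree K) : IsNullOrthogonal v := by
  intro x y hx hy
  have hx' := hx i
  have hy' := hy i
  rw [hi] at hx' hy'
  have h1 := congrFun hx' 0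
  have h2 := congrFun hx' 1
  have h3 := congrFun hy' 1
  have h4 := congrFun hy' 2
  simp [jordanThree, mulVec, vecMul, dotProduct, Fin.sum_univ_three] at h1 h2 h3 h4
  simp [dotProduct, Fin.sum_univ_three, h1, h2, h3]

lemma jordanThree_map {L : Type} [Field L] (f : K →+* L) :
    (jordanThree K).map f = jordanThree L := by
  ext i j
  fin_cases i <;> fin_cases j <;> simp [jordanThree]

lemma isAbsIndecTuple_of_jordanThree {g : ℕ} {v : MatTuple K 3 g}
    (hv : ∀ i, IsNilpotent (v i)) (i : Fin g) (hi : v i = jordanThree K) : IsAbsIndecTuple v :=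
  isAbsIndecTuple_of_isNullOrthogonal le_rfl hv
    (isNullOrthogonal_of_jordanThree i (by rw [hi, jordanThree_map]))

/-- The second entries of the indecomposable pairs of square-zero matrices whose first entry is
the matrix unit `E₀₂`. -/
def squareZeroPartner (K : Type) [Field K] : Fin 4 → Matrix (Fin 3) (Fin 3) K :=
  ![single 1 2 1, single 0 1 1, single 1 0 1, single 2 1 1]

lemma squareZeroPartner_sq (k : Fin 4) : squareZeroPartner K k ^ 2 = 0 := by
  ext i j
  fin_cases k <;> fin_cases i <;> fin_cases j <;> simp [squareZeroPartner, pow_two]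

lemma single_zero_two_sq : (single 0 2 1 : Matrix (Fin 3) (Fin 3) K) ^ 2 = 0 := by
  simp [pow_two]

lemma isNullOrthogonal_squareZeroPartner (k : Fin 4) :
    IsNullOrthogonal (![single 0 2 1, squareZeroPartner K k] : MatTuple K 3 2) := by
  intro x y hx hy
  have hx0 := hx 0
  have hx1 := hx 1
  have hy0 := hy 0
  have hy1 := hy 1
  simp only [funext_iff, Fin.forall_fin_succ, IsEmpty.forall_iff] at hx0 hx1 hy0 hy1
  fin_cases k <;>
    simp [squareZeroPartner, mulVec, vecMul, dotProduct, Fin.sum_univ_three, single] at *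
  all_goals grind

lemma squareZeroPartner_map {L : Type} [Field L] (f : K →+* L) (k : Fin 4) :
    (fun i => ((![single 0 2 1, squareZeroPartner K k] : MatTuple K 3 2) i).map f) =
      ![single 0 2 1, squareZeroPartner L k] := by
  funext i
  fin_cases i <;> fin_cases k <;> simp [squareZeroPartner]

lemma squareZeroPartner_nilpotent (k : Fin 4) (i : Fin 2) :
    IsNilpotent ((![single 0 2 1, squareZeroPartner K k] : MatTuple K 3 2) i) := by
  refine ⟨2, ?_⟩
  fin_cases i
  · exact single_zero_two_sq
  · exact squareZeroPartner_sq k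

lemma squareZeroPartner_eq_of_intertwine {k l : Fin 4} (T : (Matrix (Fin 3) (Fin 3) K)ˣ)
    (h : T.val * single 0 2 1 = single 0 2 1 * T.val)
    (hT : T.val * squareZeroPartner K k = squareZeroPartner K l * T.val) : k = l := by
  have hdet := ((isUnit_iff_isUnit_det T.val).1 T.isUnit).ne_zero
  rw [det_fin_three] at hdet
  generalize T.val = M at *
  have e00 := congrFun (congrFun h 0) 0
  have e01 := congrFun (congrFun h 0) 1
  have e02 := congrFun (congrFun h 0) 2
  have e12 := congrFun (congrFun h 1) 2
  have e22 := congrFun (congrFun h 2) 2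
  simp [mul_apply, single] at e00 e01 e02 e12 e22
  have hd : M 0 0 ≠ 0 ∧ M 1 1 ≠ 0 ∧ M 2 2 ≠ 0 := by grind
  obtain ⟨h0, h1, h2⟩ := hd
  by_contra hkl
  simp only [← Matrix.ext_iff, Fin.forall_fin_succ, IsEmpty.forall_iff] at hT
  fin_cases k <;> fin_cases l <;> first | exact hkl rfl |
    (simp [squareZeroPartner, mul_apply, single, h0, h1, h2,
      eq_comm (a := (0 : K))] at hT)

/-- Pairs of square-zero matrices with orthogonal null spaces fall into four orbits. -/
lemma exists_isConjTuple_squareZeroPartner {v : MatTuple K 3 2} (ho : IsNullOrthogonal v)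
    (h0 : v 0 ^ 2 = 0) (h1 : v 1 ^ 2 = 0) :
    ∃ k, IsConjTuple v ![single 0 2 1, squareZeroPartner K k] := by
  have hne : v 0 ≠ 0 := by
    intro hz
    by_cases hz1 : v 1 = 0
    · have := ho (Pi.single 0 1) (Pi.single 0 1)
        (fun i => by fin_cases i <;> ext j <;> simp [hz, hz1])
        (fun i => by fin_cases i <;> ext j <;> simp [hz, hz1])
      simp at this
    · obtain ⟨T, hT⟩ := exists_intertwine_single hz1 h1
      have hc : IsConjTuple v ![0, single 0 2 1] := ⟨T, fun i => by
        fin_cases i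
        · simp [hz]
        · simpa using hT⟩
      have := hc.isNullOrthogonal ho (Pi.single 1 1) (Pi.single 1 1)
        (fun i => by fin_cases i <;> ext j <;> simp [single])
        (fun i => by fin_cases i <;> ext j <;> simp [single])
      simp at this
  obtain ⟨T, hT⟩ := exists_intertwine_single hne h0
  obtain ⟨M, hM⟩ : ∃ M, M = T.val * v 1 * (T⁻¹).val := ⟨_, rfl⟩
  have hc : IsConjTuple v ![single 0 2 1, M] := ⟨T, fun i => by
    fin_cases i
    · simpa using hT
    · simp [hM, mul_assoc]⟩
  have hM2 : M ^ 2 = 0 := (hc.pow_eq_zero_iff 1 2).1 h1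
  have hMo := hc.isNullOrthogonal ho
  obtain ⟨ht, he, hd⟩ := charpoly_coeffs_of_isNilpotent (M := M) ⟨2, hM2⟩
  have hsq : ∀ i j, M i 0 * M 0 j + M i 1 * M 1 j + M i 2 * M 2 j = 0 := by
    intro i j
    simpa [pow_two, mul_apply, Fin.sum_univ_three] using congrFun (congrFun hM2 i) j
  have s00 := hsq 0 0
  have s01 := hsq 0 1
  have s02 := hsq 0 2
  have s10 := hsq 1 0
  have s11 := hsq 1 1
  have s12 := hsq 1 2
  have s20 := hsq 2 0
  have s21 := hsq 2 1
  have s22 := hsq 2 2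
  suffices ∃ (k : Fin 4) (S : Matrix (Fin 3) (Fin 3) K), S.det ≠ 0 ∧
      S * single 0 2 1 = single 0 2 1 * S ∧ S * M = squareZeroPartner K k * S by
    obtain ⟨k, S, hS0, hS1, hS2⟩ := this
    refine ⟨k, hc.trans ⟨((isUnit_iff_isUnit_det S).2 hS0.isUnit).unit, fun i => ?_⟩⟩
    fin_cases i
    · exact hS1
    · exact hS2
  clear hsq hM2 hM hc hT hne h0 h1 ho
  have m20 : M 2 0 = 0 := by
    have := hMo ![-M 2 1, M 2 0, 0] ![0, M 2 0, -M 1 0]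
      (fun i => by
        fin_cases i <;> ext j <;> fin_cases j <;>
          simp [mulVec, dotProduct, Fin.sum_univ_three, single] <;> grind)
      (fun i => by
        fin_cases i <;> ext j <;> fin_cases j <;>
          simp [vecMul, dotProduct, Fin.sum_univ_three, single] <;> grind)
    simpa [dotProduct, Fin.sum_univ_three] using this
  have hcomm : ∀ a b c d : K, !![1, a, b; 0, c, d; 0, 0, 1] * single 0 2 1 =
      single 0 2 1 * !![1, a, b; 0, c, d; 0, 0, 1] := by
    intro a b c d
    ext i j
    fin_cases i <;> fin_cases j <;> simp [single, mul_apply]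
  by_cases m21 : M 2 1 = 0
  · by_cases m10 : M 1 0 = 0
    · have m22 : M 2 2 = 0 := by grind
      have m11 : M 1 1 = 0 := by grind
      have m00 : M 0 0 = 0 := by grind
      by_cases m12 : M 1 2 = 0
      · have m01 : M 0 1 ≠ 0 := by
          intro m01
          have := hMo (Pi.single 1 1) (Pi.single 1 1)
            (fun i => by fin_cases i <;> ext j <;> fin_cases j <;> simp [single, *])
            (fun i => by fin_cases i <;> ext j <;> fin_cases j <;> simp [single, *])
          simp at this
        refine ⟨1, !![1, 0, 0; 0, M 0 1, M 0 2; 0, 0, 1], ?_, hcomm _ _ _ _, ?_⟩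
        · simpa [det_fin_three] using m01
        · ext i j
          fin_cases i <;> fin_cases j <;>
            simp [squareZeroPartner, single, mul_apply, Fin.sum_univ_three, *]
      · refine ⟨0, !![1, -M 0 2 / M 1 2, 0; 0, (M 1 2)⁻¹, 0; 0, 0, 1], ?_, hcomm _ _ _ _, ?_⟩
        · simpa [det_fin_three] using m12
        · have m01 : M 0 1 = 0 := by grind
          ext i j
          fin_cases i <;> fin_cases j <;>
            simp [squareZeroPartner, single, mul_apply, Fin.sum_univ_three, *]
    · refine ⟨2, !![1, M 1 1 / M 1 0, M 1 2 / M 1 0; 0, (M 1 0)⁻¹, 0; 0, 0, 1], ?_,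
        hcomm _ _ _ _, ?_⟩
      · simpa [det_fin_three] using m10
      · have m22 : M 2 2 = 0 := by grind
        ext i j
        fin_cases i <;> fin_cases j <;>
          simp [squareZeroPartner, single, mul_apply, Fin.sum_univ_three] <;> grind
  · refine ⟨3, !![1, 0, -M 0 1 / M 2 1; 0, M 2 1, M 2 2; 0, 0, 1], ?_, hcomm _ _ _ _, ?_⟩
    · simpa [det_fin_three] using m21
    · have m10 : M 1 0 = 0 := by grind
      ext i j
      fin_cases i <;> fin_cases j <;>
        simp [squareZeroPartner, single, mul_apply, Fin.sum_univ_three] <;> grind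

lemma exists_intertwine_reducedMatrix {A M : Matrix (Fin 3) (Fin 3) K} (hA : IsNilpotent A)
    (hA2 : A ^ 2 ≠ 0) (hM : IsNilpotent M) :
    ∃ (a : ReducedIndex K) (T : (Matrix (Fin 3) (Fin 3) K)ˣ),
      T.val * A = jordanThree K * T.val ∧ T.val * M = reducedMatrix a * T.val := by
  obtain ⟨T, hT⟩ := exists_intertwine_jordanThree hA hA2
  have hM' := (isConjTuple_conj T (fun _ : Fin 1 => M)).isNilpotent (fun _ => hM) 0
  obtain ⟨b, c, hred⟩ := exists_isJordanReduced hM'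
  set C := jordanCentralizer b c with hC
  have hM'' := (isConjTuple_conj C (fun _ : Fin 1 => T.val * M * (T⁻¹).val)).isNilpotent
    (fun _ => hM') 0
  obtain ⟨a, ha⟩ := hred.exists_eq_reducedMatrix hM''
  refine ⟨a, C * T, ?_, ?_⟩
  · rw [Units.val_mul, mul_assoc, hT, ← mul_assoc, jordanCentralizer_comm, mul_assoc]
  · rw [ha]
    simp [mul_assoc]

/-- Representatives of the absolutely indecomposable orbits of pairs of nilpotent `3 × 3`
matrices. -/
def pairThree : ReducedIndex K ⊕ SquareZeroIndex K ⊕ Fin 4 → MatTuple K 3 2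
  | .inl a => ![jordanThree K, reducedMatrix a]
  | .inr (.inl b) => ![reducedMatrix b.toReduced, jordanThree K]
  | .inr (.inr k) => ![single 0 2 1, squareZeroPartner K k]

lemma isNilpotent_pairThree (a : ReducedIndex K ⊕ SquareZeroIndex K ⊕ Fin 4) (i : Fin 2) :
    IsNilpotent (pairThree a i) := by
  rcases a with a | b | k
  · fin_cases i
    · exact isNilpotent_jordanThree
    · exact isNilpotent_reducedMatrix a
  · fin_cases i
    · exact isNilpotent_reducedMatrix _
    · exact isNilpotent_jordanThree
  · exact squareZeroPartner_nilpotent k i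

lemma isAbsIndecTuple_pairThree (a : ReducedIndex K ⊕ SquareZeroIndex K ⊕ Fin 4) :
    IsAbsIndecTuple (pairThree a) := by
  rcases a with a | b | k
  · exact isAbsIndecTuple_of_jordanThree (isNilpotent_pairThree _) 0 rfl
  · exact isAbsIndecTuple_of_jordanThree (isNilpotent_pairThree _) 1 rfl
  · refine isAbsIndecTuple_of_isNullOrthogonal le_rfl (isNilpotent_pairThree _) ?_
    simp only [pairThree, squareZeroPartner_map]
    exact isNullOrthogonal_squareZeroPartner k

lemma pairThree_eq_of_isConjTuple (a b : ReducedIndex K ⊕ SquareZeroIndex K ⊕ Fin 4)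
    (h : IsConjTuple (pairThree a) (pairThree b)) : a = b := by
  have h0 := h.pow_eq_zero_iff 0 2
  have h1 := h.pow_eq_zero_iff 1 2
  obtain ⟨T, hT⟩ := h
  have hT0 := hT 0
  have hT1 := hT 1
  rcases a with a | a | a <;> rcases b with b | b | b <;>
    simp only [pairThree, cons_val_zero, cons_val_one, jordanThree_sq_ne_zero,
      SquareZeroIndex.sq_eq_zero, single_zero_two_sq, squareZeroPartner_sq, iff_true, iff_false,
      not_true_eq_false] at h0 h1 hT0 hT1
  · rw [reducedMatrix_injective ((isJordanReduced_reducedMatrix a).eq_of_intertwine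
      (isJordanReduced_reducedMatrix b) T hT0 hT1)]
  · rw [SquareZeroIndex.toReduced_injective (reducedMatrix_injective
      ((isJordanReduced_reducedMatrix _).eq_of_intertwine
        (isJordanReduced_reducedMatrix _) T hT1 hT0))]
  · rw [squareZeroPartner_eq_of_intertwine T hT0 hT1]

lemma exists_isConjTuple_pairThree (v : MatTuple K 3 2) (hv : ∀ i, IsNilpotent (v i))
    (hi : IsAbsIndecTuple v) : ∃ a, IsConjTuple v (pairThree a) := by
  by_cases h0 : v 0 ^ 2 = 0
  · by_cases h1 : v 1 ^ 2 = 0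
    · obtain ⟨k, hk⟩ :=
        exists_isConjTuple_squareZeroPartner (isNullOrthogonal_of_isAbsIndecTuple hi) h0 h1
      exact ⟨.inr (.inr k), hk⟩
    · obtain ⟨a, T, hT1, hT0⟩ := exists_intertwine_reducedMatrix (hv 1) h1 (hv 0)
      have hc : IsConjTuple v ![reducedMatrix a, jordanThree K] :=
        ⟨T, Fin.forall_fin_two.2 ⟨hT0, hT1⟩⟩
      obtain ⟨b, rfl⟩ := exists_toReduced_eq ((hc.pow_eq_zero_iff 0 2).1 h0)
      exact ⟨.inr (.inl b), hc⟩
  · obtain ⟨a, T, hT0, hT1⟩ := exists_intertwine_reducedMatrix (hv 0) h0 (hv 1)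
    exact ⟨.inl a, T, Fin.forall_fin_two.2 ⟨hT0, hT1⟩⟩

end Three

lemma Acount_two_three (F : Type) [Field F] [Fintype F] :
    Acount F 2 3 =
      Fintype.card F ^ 4 + 3 * Fintype.card F ^ 2 + 2 * Fintype.card F := by
  classical
  rw [Acount_eq_card pairThree isNilpotent_pairThree isAbsIndecTuple_pairThree
    pairThree_eq_of_isConjTuple exists_isConjTuple_pairThree, Nat.card_eq_fintype_card]
  obtain ⟨m, hm⟩ := Nat.exists_eq_succ_of_ne_zero (Fintype.card_ne_zero (α := F))
  simp only [Fintype.card_sum, Fintype.card_prod, Fintype.card_units, Fintype.card_fin, hm,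
    Nat.succ_eq_add_one, Nat.add_sub_cancel]
  ring

section Two

variable {K : Type} [Field K]

/-- The nilpotent Jordan block of size two. -/
def jordanTwo (K : Type) [Field K] : Matrix (Fin 2) (Fin 2) K := !![0, 1; 0, 0]

lemma sq_eq_zero_of_isNilpotent {M : Matrix (Fin 2) (Fin 2) K} (h : IsNilpotent M) :
    M ^ 2 = 0 := by
  have := aeval_self_charpoly M
  rw [(isNilpotent_charpoly_sub_pow_of_isNilpotent h).eq_zero |> sub_eq_zero.1] at this
  simpa using this

lemma charpoly_coeffs_of_isNilpotent_two {M : Matrix (Fin 2) (Fin 2) K} (h : IsNilpotent M) :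
    M 1 1 = -M 0 0 ∧ M 0 0 ^ 2 + M 0 1 * M 1 0 = 0 := by
  have h2 := sq_eq_zero_of_isNilpotent h
  have e00 := congrFun (congrFun h2 0) 0
  have ht := (isNilpotent_trace_of_isNilpotent h).eq_zero
  rw [trace_fin_two] at ht
  simp only [pow_two, mul_apply, Fin.sum_univ_two, Matrix.zero_apply] at e00
  exact ⟨by linear_combination ht, by linear_combination e00⟩

lemma exists_intertwine_jordanTwo {M : Matrix (Fin 2) (Fin 2) K} (h : IsNilpotent M)
    (h0 : M ≠ 0) :
    ∃ T : (Matrix (Fin 2) (Fin 2) K)ˣ, T.val * M = jordanTwo K * T.val := by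
  obtain ⟨ht, hd⟩ := charpoly_coeffs_of_isNilpotent_two h
  suffices ∃ T : Matrix (Fin 2) (Fin 2) K, T.det ≠ 0 ∧ T * M = jordanTwo K * T by
    obtain ⟨T, hT, hTM⟩ := this
    exact ⟨((isUnit_iff_isUnit_det T).2 hT.isUnit).unit, hTM⟩
  by_cases hz : M 1 0 = 0
  · have h00 : M 0 0 = 0 := by simpa [hz] using hd
    refine ⟨!![1, 0; 0, M 0 1], ?_, ?_⟩
    · intro hdet
      apply h0
      ext i j
      fin_cases i <;> fin_cases j <;> simp_all [det_fin_two]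
    · ext i j
      fin_cases i <;> fin_cases j <;> simp [mul_apply, Fin.sum_univ_two, jordanTwo, *]
  · refine ⟨!![0, 1; M 1 0, M 1 1], by simpa [det_fin_two] using hz, ?_⟩
    ext i j
    fin_cases i <;> fin_cases j <;> simp [mul_apply, Fin.sum_univ_two, jordanTwo] <;> grind

/-- Representatives of the absolutely indecomposable orbits of pairs of nilpotent `2 × 2`
matrices. -/
def pairTwo : K ⊕ Kˣ ⊕ Unit → MatTuple K 2 2
  | .inl y => ![jordanTwo K, !![0, y; 0, 0]]
  | .inr (.inl z) => ![jordanTwo K, !![0, 0; (z : K), 0]]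
  | .inr (.inr _) => ![0, jordanTwo K]

lemma isNilpotent_pairTwo (a : K ⊕ Kˣ ⊕ Unit) (i : Fin 2) : IsNilpotent (pairTwo a i) := by
  refine ⟨2, ?_⟩
  ext j k
  rcases a with a | b | c <;> fin_cases i <;> fin_cases j <;> fin_cases k <;>
    simp [pairTwo, jordanTwo, pow_two, mul_apply, Fin.sum_univ_two]

lemma isNullOrthogonal_of_jordanTwo {g : ℕ} {v : MatTuple K 2 g} (i : Fin g)
    (hi : v i = jordanTwo K) : IsNullOrthogonal v := by
  intro x y hx hy
  have hx' := hx i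
  have hy' := hy i
  rw [hi] at hx' hy'
  have h1 := congrFun hx' 0
  have h2 := congrFun hy' 1
  simp [jordanTwo, mulVec, vecMul, dotProduct, Fin.sum_univ_two] at h1 h2
  simp [dotProduct, Fin.sum_univ_two, h1, h2]

lemma jordanTwo_map {L : Type} [Field L] (f : K →+* L) :
    (jordanTwo K).map f = jordanTwo L := by
  ext i j
  fin_cases i <;> fin_cases j <;> simp [jordanTwo]

lemma isAbsIndecTuple_of_jordanTwo {g : ℕ} {v : MatTuple K 2 g}
    (hv : ∀ i, IsNilpotent (v i)) (i : Fin g) (hi : v i = jordanTwo K) : IsAbsIndecTuple v :=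
  isAbsIndecTuple_of_isNullOrthogonal (by norm_num) hv
    (isNullOrthogonal_of_jordanTwo i (by rw [hi, jordanTwo_map]))

lemma isAbsIndecTuple_pairTwo (a : K ⊕ Kˣ ⊕ Unit) : IsAbsIndecTuple (pairTwo a) := by
  rcases a with a | b | c
  · exact isAbsIndecTuple_of_jordanTwo (isNilpotent_pairTwo _) 0 rfl
  · exact isAbsIndecTuple_of_jordanTwo (isNilpotent_pairTwo _) 0 rfl
  · exact isAbsIndecTuple_of_jordanTwo (isNilpotent_pairTwo _) 1 rfl

lemma pairTwo_eq_of_isConjTuple (a b : K ⊕ Kˣ ⊕ Unit)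
    (h : IsConjTuple (pairTwo a) (pairTwo b)) : a = b := by
  obtain ⟨T, hT⟩ := h
  have hdet := ((isUnit_iff_isUnit_det T.val).1 T.isUnit).ne_zero
  rw [det_fin_two] at hdet
  have hT0 := hT 0
  have hT1 := hT 1
  simp only [← Matrix.ext_iff, Fin.forall_fin_two, mul_apply, Fin.sum_univ_two] at hT0 hT1
  rcases a with a | a | a <;> rcases b with b | b | b <;>
    simp [pairTwo, jordanTwo] at hT0 hT1 ⊢
  all_goals try have := a.ne_zero
  all_goals try have := b.ne_zero
  all_goals try rw [Units.ext_iff]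
  all_goals grind

lemma exists_isConjTuple_pairTwo (v : MatTuple K 2 2) (hv : ∀ i, IsNilpotent (v i))
    (hi : IsAbsIndecTuple v) : ∃ a, IsConjTuple v (pairTwo a) := by
  by_cases h0 : v 0 = 0
  · by_cases h1 : v 1 = 0
    · exfalso
      refine hi (isDecomposableTuple_of_isolated (m := 1) one_pos fun i j _ => ?_)
      fin_cases i <;> simp [h0, h1]
    · obtain ⟨T, hT⟩ := exists_intertwine_jordanTwo (hv 1) h1
      exact ⟨.inr (.inr ()), T, Fin.forall_fin_two.2 ⟨by simp [h0, pairTwo], hT⟩⟩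
  · obtain ⟨T, hT⟩ := exists_intertwine_jordanTwo (hv 0) h0
    obtain ⟨M, hM⟩ : ∃ M, M = T.val * v 1 * (T⁻¹).val := ⟨_, rfl⟩
    have hc : IsConjTuple v ![jordanTwo K, M] :=
      ⟨T, Fin.forall_fin_two.2 ⟨hT, by simp [hM, mul_assoc]⟩⟩
    obtain ⟨ht, hd⟩ := charpoly_coeffs_of_isNilpotent_two (hc.isNilpotent hv 1)
    simp only [cons_val_one, cons_val_zero] at ht hd
    by_cases hz : M 1 0 = 0
    · have h00 : M 0 0 = 0 := by simpa [hz] using hd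
      refine ⟨.inl (M 0 1), ?_⟩
      have : M = !![0, M 0 1; 0, 0] := by
        ext i j
        fin_cases i <;> fin_cases j <;> simp [hz, h00, ht]
      rwa [this] at hc
    · refine ⟨.inr (.inl (Units.mk0 _ hz)), hc.trans ⟨((isUnit_iff_isUnit_det
        !![1, -M 0 0 / M 1 0; 0, 1]).2 (by simp [det_fin_two])).unit, Fin.forall_fin_two.2 ?_⟩⟩
      constructor <;> ext i j <;> fin_cases i <;> fin_cases j <;>
        simp [pairTwo, jordanTwo, mul_apply, Fin.sum_univ_two] <;> grind

end Two

lemma Acount_two_two (F : Type) [Field F] [Fintype F] :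
    Acount F 2 2 = 2 * Fintype.card F := by
  classical
  rw [Acount_eq_card pairTwo isNilpotent_pairTwo isAbsIndecTuple_pairTwo
    pairTwo_eq_of_isConjTuple exists_isConjTuple_pairTwo, Nat.card_eq_fintype_card]
  have := Fintype.card_pos (α := F)
  simp only [Fintype.card_sum, Fintype.card_units, Fintype.card_unit]
  omega

lemma Acount_one (F : Type) [Field F] (g : ℕ) : Acount F g 1 = 1 := by
  rw [Acount_eq_card (fun _ : Unit => 0) (fun _ _ => IsNilpotent.zero), Nat.card_unique]
  · rintro - ⟨d₁, d₂, h₁, h₂, h, -⟩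
    omega
  · exact fun _ _ _ => rfl
  · intro v hv _
    refine ⟨(), 1, fun i => ?_⟩
    have : v i = 0 := by
      have h00 := (isNilpotent_trace_of_isNilpotent (hv i)).eq_zero
      rw [trace_fin_one] at h00
      ext a b
      rw [Subsingleton.elim a 0, Subsingleton.elim b 0]
      simpa using h00
    simp [this]

end NilpotentTuple

/-- `A_2(1,q) = 1`, `A_2(2,q) = 2q` and `A_2(3,q) = q⁴ + 3q² + 2q` for every finite
field with `q` elements. -/
theorem Acount_two_small (F : Type) [Field F] [Fintype F] :
    Acount F 2 1 = 1 ∧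
    Acount F 2 2 = 2 * Fintype.card F ∧
    Acount F 2 3 =
      Fintype.card F ^ 4 + 3 * Fintype.card F ^ 2 + 2 * Fintype.card F := by
  exact ⟨NilpotentTuple.Acount_one F 2, NilpotentTuple.Acount_two_two F,
    NilpotentTuple.Acount_two_three F⟩
end
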